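/- Let n ≥ 1, let A, B ∈ ℂ^{n×n} with A† = A and Bᵀ = B, let Ω = diag(Ω_1, …, Ω_n) and Ω̃ = diag(Ω̃_1, …, Ω̃_n) be real diagonal matrices, and let X, Y ∈ ℂ^{n×n} be such that M = [[X, conj(Y)], [Y, conj(X)]] satisfies both M† J M = J and J·[[A, B], [conj(B), conj(A)]]·M = M·diag(Ω, −Ω), where J = diag(I_n, −I_n). Writing x_i = X e_i and y_i = Y e_i for the columns of X and Y, define Ã = A + Σ_{i=1}^{n} (Ω̃_i − Ω_i)( x_i x_i† + conj(y_i y_i†) ) and B̃ = B − Σ_{i=1}^{n} (Ω̃_i − Ω_i)( x_i y_i† + (x_i y_i†)ᵀ ). Then Ã† = Ã, B̃ᵀ = B̃, and J·[[Ã, B̃], [conj(B̃), conj(Ã)]]·M = M·diag(Ω̃, −Ω̃); i.e., the modified QRPA matrix has the same eigenvectors X, Y but eigenfrequencies Ω̃_i in place of Ω_i. -/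

import Mathlib

open Matrix

theorem mul_diagonal_mul_eq_sum {l m n R : Type*} [Fintype m] [DecidableEq m] [CommSemiring R]
    (P : Matrix l m R) (d : m → R) (Q : Matrix m n R) :
    P * diagonal d * Q = ∑ i, d i • Matrix.of (fun a b => P a i * Q i b) := by
  ext a b
  rw [mul_apply]
  simp only [mul_diagonal, Matrix.sum_apply, Matrix.smul_apply, of_apply, smul_eq_mul]
  exact Finset.sum_congr rfl fun i _ => by ring

theorem qrpa_spurious_mode_shift (n : ℕ) (hn : 1 ≤ n)
    (A B : Matrix (Fin n) (Fin n) ℂ)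
    (hA : Aᴴ = A) (hB : Bᵀ = B)
    (Ωd Ωtd : Fin n → ℝ)
    (X Y : Matrix (Fin n) (Fin n) ℂ)
    (J M : Matrix (Fin n ⊕ Fin n) (Fin n ⊕ Fin n) ℂ)
    (hJ : J = Matrix.fromBlocks 1 0 0 (-1))
    (hM : M = Matrix.fromBlocks X (Y.map (starRingEnd ℂ)) Y (X.map (starRingEnd ℂ)))
    (horth : Mᴴ * J * M = J)
    (heig : J * Matrix.fromBlocks A B (B.map (starRingEnd ℂ)) (A.map (starRingEnd ℂ)) * M =
      M * Matrix.fromBlocks (Matrix.diagonal fun i => (Ωd i : ℂ)) 0 0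
        (-(Matrix.diagonal fun i => (Ωd i : ℂ))))
    (At Bt : Matrix (Fin n) (Fin n) ℂ)
    (hAt : At = A + ∑ i, ((Ωtd i - Ωd i : ℝ) : ℂ) •
      (Matrix.of (fun a b => X a i * (starRingEnd ℂ) (X b i)) +
       (Matrix.of (fun a b => Y a i * (starRingEnd ℂ) (Y b i))).map (starRingEnd ℂ)))
    (hBt : Bt = B - ∑ i, ((Ωtd i - Ωd i : ℝ) : ℂ) •
      (Matrix.of (fun a b => X a i * (starRingEnd ℂ) (Y b i)) +
       (Matrix.of (fun a b => X a i * (starRingEnd ℂ) (Y b i)))ᵀ)) :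
    Atᴴ = At ∧ Btᵀ = Bt ∧
    J * Matrix.fromBlocks At Bt (Bt.map (starRingEnd ℂ)) (At.map (starRingEnd ℂ)) * M =
      M * Matrix.fromBlocks (Matrix.diagonal fun i => (Ωtd i : ℂ)) 0 0
        (-(Matrix.diagonal fun i => (Ωtd i : ℂ))) := by
  set D : Matrix (Fin n) (Fin n) ℂ := diagonal fun i => ((Ωtd i - Ωd i : ℝ) : ℂ) with hD
  have hDH : Dᴴ = D := by
    rw [hD, diagonal_conjTranspose]
    congr 1
    ext i
    simp
  have hDT : Dᵀ = D := diagonal_transpose _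
  have hA' : At = A + (X * D * Xᴴ + Y.map (starRingEnd ℂ) * D * Yᵀ) := by
    rw [hAt, mul_diagonal_mul_eq_sum, mul_diagonal_mul_eq_sum, ← Finset.sum_add_distrib]
    congr 1
    refine Finset.sum_congr rfl fun i _ => ?_
    ext a b
    simp [mul_add]
  have hB' : Bt = B - (X * D * Yᴴ + Y.map (starRingEnd ℂ) * D * Xᵀ) := by
    rw [hBt, mul_diagonal_mul_eq_sum, mul_diagonal_mul_eq_sum, ← Finset.sum_add_distrib]
    congr 1
    refine Finset.sum_congr rfl fun i _ => ?_
    ext a b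
    simp [mul_add, mul_comm]
  have hconj (Z : Matrix (Fin n) (Fin n) ℂ) : Z.map (starRingEnd ℂ) = Zᴴᵀ := rfl
  have hTH (Z : Matrix (Fin n) (Fin n) ℂ) : Zᵀᴴ = Zᴴᵀ := rfl
  have hMH : Mᴴ = fromBlocks Xᴴ Yᴴ Yᵀ Xᵀ := by
    rw [hM, fromBlocks_conjTranspose]
    simp [hconj, hTH]
  have hblocks : fromBlocks At Bt (Bt.map (starRingEnd ℂ)) (At.map (starRingEnd ℂ)) =
      fromBlocks A B (B.map (starRingEnd ℂ)) (A.map (starRingEnd ℂ)) +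
        J * (M * fromBlocks D 0 0 D * Mᴴ) * J := by
    rw [hMH, hM, hJ, hA', hB']
    simp [fromBlocks_multiply, fromBlocks_add, hconj, hDH, hDT, conjTranspose_mul,
      Matrix.mul_assoc, sub_eq_add_neg, hTH, add_comm]
  refine ⟨?_, ?_, ?_⟩
  · rw [hA']
    simp [hconj, hA, hDH, conjTranspose_mul, Matrix.mul_assoc, hTH]
  · rw [hB']
    simp [hconj, hB, hDT, transpose_mul, Matrix.mul_assoc, add_comm]
  · have hJJ : J * J = 1 := by
      rw [hJ]
      simp [fromBlocks_multiply]
    rw [hblocks, Matrix.mul_add, Matrix.add_mul, heig]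
    calc
      _ = M * fromBlocks (diagonal fun i => (Ωd i : ℂ)) 0 0 (-(diagonal fun i => (Ωd i : ℂ))) +
            (J * J) * M * fromBlocks D 0 0 D * (Mᴴ * J * M) := by
          simp only [Matrix.mul_assoc]
      _ = _ := by
          rw [hJJ, horth, Matrix.one_mul, Matrix.mul_assoc, ← Matrix.mul_add, hJ]
          congr 1
          rw [fromBlocks_multiply, fromBlocks_add]
          congr 1 <;> ext i j <;> simp [hD, diagonal_apply] <;> split_ifs <;> ring
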